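/- Let P be a string of length m over a finite alphabet Σ, and let A(P) be the NFA with states q_0,…,q_m, initial state q_0, where δ(q_0,c) = {q_0,q_1} if c = P[0] and {q_0} otherwise, and δ(q_i,c) = {q_{i+1}} if 1 ≤ i < m and c = P[i], ∅ otherwise. Let I(P) = { α_P(i) : 0 ≤ i ≤ |rle(P)| } be the set of starting positions of the runs of P together with m. Let S be a string with run-length encoding of length at least j+1, for some j ≥ 0, and for 0 ≤ t ≤ |S| write D_t = δ*(q_0, S[0..t−1]) for the configuration of A(P) after reading the first t symbols of S. Then D_{α_S(j+1)} = ⋃ { δ*(q, S[α_S(j)]^{ℓ_S(j)}) : q ∈ D_{α_S(j)} and the index of q lies in I(P) }, i.e., the configuration at the end of run j of S is obtained by applying the run S[α_S(j)]^{ℓ_S(j)} only to those states of the previous configuration whose index is a run starting position of P (Equation (1) of the paper, a consequence of Lemma 1). -/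

import Mathlib

/-- Decoding of a run-length encoding: concatenation of the runs. -/
def decodeRLE {α : Type*} (r : List (α × ℕ)) : List α :=
  r.foldr (fun p acc => List.replicate p.2 p.1 ++ acc) []

/-- `IsRLE r S` : `r` is the run-length encoding of `S`
    (all run lengths are ≥ 1, adjacent runs have distinct symbols, decoding gives `S`). -/
def IsRLE {α : Type*} (r : List (α × ℕ)) (S : List α) : Prop :=
  (∀ p ∈ r, 1 ≤ p.2) ∧ List.Chain' (fun p q => p.1 ≠ q.1) r ∧ decodeRLE r = S

/-- `rleStart r k` = α(k), the starting position of run `k` (sum of lengths of runs before `k`). -/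
def rleStart {α : Type*} (r : List (α × ℕ)) (k : ℕ) : ℕ :=
  ((r.take k).map Prod.snd).sum


/-- Configurations of an NFA: set of states reachable from the set `I` by reading the string,
    iterating the transition function over the symbols. -/
def nfaDeltaStar {σ β : Type*} (δ : σ → β → Set σ) : Set σ → List β → Set σ
  | I, [] => I
  | I, c :: u => nfaDeltaStar δ (⋃ q ∈ I, δ q c) u


/-- Transition function of the nondeterministic KMP (prefix) automaton `A(P)` for `Σ* P`:
    states are `0, 1, …, |P|`; `δ(0, c) ∋ 0` always (self-loop on every symbol), and
    `δ(i, c) ∋ i+1` iff `i < |P|` and `c = P[i]`. -/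
def kmpDelta {α : Type*} (P : List α) (q : ℕ) (c : α) : Set ℕ :=
  {q' | (q = 0 ∧ q' = 0) ∨ (q' = q + 1 ∧ P[q]? = some c)}

theorem decodeRLE_cons {α : Type*} (p : α × ℕ) (r : List (α × ℕ)) :
    decodeRLE (p :: r) = List.replicate p.2 p.1 ++ decodeRLE r := rfl

theorem decodeRLE_append {α : Type*} (r s : List (α × ℕ)) :
    decodeRLE (r ++ s) = decodeRLE r ++ decodeRLE s := by
  induction r with
  | nil => rfl
  | cons p r ih => simp [decodeRLE_cons, ih]

theorem length_decodeRLE {α : Type*} (r : List (α × ℕ)) :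
    (decodeRLE r).length = (r.map Prod.snd).sum := by
  induction r with
  | nil => rfl
  | cons p r ih => simp [decodeRLE_cons, ih]

theorem take_rleStart_decodeRLE {α : Type*} (r : List (α × ℕ)) (k : ℕ) :
    (decodeRLE r).take (rleStart r k) = decodeRLE (r.take k) := by
  conv_lhs => rw [← List.take_append_drop k r, decodeRLE_append]
  rw [List.take_append_drop, rleStart, ← length_decodeRLE, List.take_left]

theorem decodeRLE_take_succ {α : Type*} (r : List (α × ℕ)) (k : ℕ) (hk : k < r.length) :
    decodeRLE (r.take (k + 1)) = decodeRLE (r.take k) ++ List.replicate r[k].2 r[k].1 := by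
  rw [← List.take_concat_get' r k hk, decodeRLE_append]
  simp [decodeRLE]

theorem getElem?_decodeRLE_rleStart {α : Type*} (r : List (α × ℕ)) (k : ℕ) (hk : k < r.length)
    (hpos : 1 ≤ r[k].2) : (decodeRLE r)[rleStart r k]? = some r[k].1 := by
  conv_lhs => rw [← List.take_append_drop k r, decodeRLE_append]
  rw [List.take_append_drop, rleStart, ← length_decodeRLE,
    List.getElem?_append_right le_rfl, Nat.sub_self, List.drop_eq_getElem_cons hk, decodeRLE_cons,
    List.getElem?_append_left (by simp; omega), List.getElem?_replicate_of_lt (by omega)]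

/-- A position whose symbol differs from the previous one is the start of a run. -/
theorem exists_rleStart_eq_of_ne {α : Type*} (r : List (α × ℕ)) (q : ℕ) (c d : α)
    (hc : (decodeRLE r)[q]? = some c) (hd : (decodeRLE r)[q + 1]? = some d) (hcd : c ≠ d) :
    ∃ i ≤ r.length, q + 1 = rleStart r i := by
  induction r generalizing q with
  | nil => simp [decodeRLE] at hc
  | cons p r ih =>
    rw [decodeRLE_cons] at hc hd
    rcases lt_trichotomy (q + 1) p.2 with h | h | h
    · rw [List.getElem?_append_left (by simp; omega), List.getElem?_replicate_of_lt (by omega)]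
        at hc hd
      exact absurd (Option.some.inj (hc.symm.trans hd)) hcd
    · exact ⟨1, by simp, by simp [rleStart, h]⟩
    · rw [List.getElem?_append_right (by simp; omega), List.length_replicate] at hc hd
      rw [show q + 1 - p.2 = q - p.2 + 1 by omega] at hd
      obtain ⟨i, hi, hqi⟩ := ih _ hc hd
      refine ⟨i + 1, by simpa using hi, ?_⟩
      simp only [rleStart, List.take_succ_cons, List.map_cons, List.sum_cons] at hqi ⊢
      omega

theorem nfaDeltaStar_append {σ β : Type*} (δ : σ → β → Set σ) (I : Set σ) (u v : List β) :
    nfaDeltaStar δ I (u ++ v) = nfaDeltaStar δ (nfaDeltaStar δ I u) v := by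
  induction u generalizing I with
  | nil => rfl
  | cons c u ih => exact ih _

theorem nfaDeltaStar_iUnion {σ β ι : Type*} (δ : σ → β → Set σ) (I : ι → Set σ) (u : List β) :
    nfaDeltaStar δ (⋃ i, I i) u = ⋃ i, nfaDeltaStar δ (I i) u := by
  induction u generalizing I with
  | nil => rfl
  | cons c u ih =>
    simp only [nfaDeltaStar, ← ih]
    congr 1
    ext x
    simp only [Set.mem_iUnion]
    grind

theorem nfaDeltaStar_eq_biUnion {σ β : Type*} (δ : σ → β → Set σ) (I : Set σ) (u : List β) :
    nfaDeltaStar δ I u = ⋃ q ∈ I, nfaDeltaStar δ {q} u := by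
  conv_lhs => rw [← Set.iUnion_of_singleton_coe I, nfaDeltaStar_iUnion]
  exact Set.iUnion_coe_set I _

theorem nfaDeltaStar_empty {σ β : Type*} (δ : σ → β → Set σ) (u : List β) :
    nfaDeltaStar δ ∅ u = ∅ := by
  rw [nfaDeltaStar_eq_biUnion]; simp

theorem nfaDeltaStar_kmpDelta_replicate_eq_empty {α : Type*} (P : List α) (q n : ℕ) (c : α)
    (hn : 1 ≤ n) (hq : q ≠ 0) (hc : P[q]? ≠ some c) :
    nfaDeltaStar (kmpDelta P) {q} (List.replicate n c) = ∅ := by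
  obtain ⟨n, rfl⟩ := Nat.exists_eq_add_of_le' hn
  have h : kmpDelta P q c = ∅ := by
    ext x
    simp [kmpDelta, hq, hc]
  simp [List.replicate_succ, nfaDeltaStar, h, nfaDeltaStar_empty]

theorem getElem?_of_succ_mem_nfaDeltaStar {α : Type*} (P : List α) (I : Set ℕ) (u : List α)
    (c : α) (q : ℕ) (h : q + 1 ∈ nfaDeltaStar (kmpDelta P) I (u ++ [c])) : P[q]? = some c := by
  rw [nfaDeltaStar_append] at h
  simp only [nfaDeltaStar, Set.mem_iUnion, kmpDelta, Set.mem_ofPred_eq] at h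
  grind

theorem stmt_18 {α : Type*} [Fintype α] [Inhabited α] (P S : List α)
    (rP rS : List (α × ℕ))
    (hP : IsRLE rP P) (hS : IsRLE rS S)
    (j : ℕ) (hj : j + 1 ≤ rS.length) :
    nfaDeltaStar (kmpDelta P) {0} (S.take (rleStart rS (j + 1))) =
      ⋃ q ∈ (nfaDeltaStar (kmpDelta P) {0} (S.take (rleStart rS j)) ∩
              {q | ∃ i ≤ rP.length, q = rleStart rP i}),
        nfaDeltaStar (kmpDelta P) {q}
          (List.replicate (rS[j]'(by omega)).2 (S.getD (rleStart rS j) default)) := by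
  have hj' : j < rS.length := hj
  obtain ⟨hpos, hchain, rfl⟩ := hS
  obtain ⟨-, -, rfl⟩ := hP
  have hlen : 1 ≤ rS[j].2 := hpos _ (List.getElem_mem hj')
  have hget : (decodeRLE rS).getD (rleStart rS j) default = rS[j].1 := by
    rw [List.getD_eq_getElem?_getD, getElem?_decodeRLE_rleStart rS j hj' hlen, Option.getD_some]
  rw [hget, take_rleStart_decodeRLE, take_rleStart_decodeRLE, decodeRLE_take_succ rS j hj',
    nfaDeltaStar_append, nfaDeltaStar_eq_biUnion]
  refine subset_antisymm ?_ (Set.biUnion_subset_biUnion_left Set.inter_subset_left)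
  refine Set.iUnion₂_subset fun q hq => ?_
  by_cases hI : ∃ i ≤ rP.length, q = rleStart rP i
  · exact Set.subset_biUnion_of_mem
      (u := fun q => nfaDeltaStar (kmpDelta (decodeRLE rP)) {q} (List.replicate rS[j].2 rS[j].1))
      ⟨hq, hI⟩
  obtain _ | q := q
  · exact absurd ⟨0, Nat.zero_le _, by simp [rleStart]⟩ hI
  rw [nfaDeltaStar_kmpDelta_replicate_eq_empty _ _ _ _ hlen q.succ_ne_zero]
  · exact Set.empty_subset _
  intro hc
  obtain _ | j := j
  · simp [decodeRLE, nfaDeltaStar] at hq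
  have hlen' : 1 ≤ rS[j].2 := hpos _ (List.getElem_mem (by omega))
  obtain ⟨n, hn⟩ := Nat.exists_eq_add_of_le' hlen'
  rw [decodeRLE_take_succ rS j (by omega), hn, List.replicate_succ', ← List.append_assoc] at hq
  exact hI (exists_rleStart_eq_of_ne rP q _ _ (getElem?_of_succ_mem_nfaDeltaStar _ _ _ _ _ hq) hc
    (List.isChain_iff_getElem.mp hchain j hj'))
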